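/- Define g₀(x) = sgn(x) on (−1,1) and recursively, for m ≥ 1, g_m(x) = ∫₀ˣ g_{m−1}(y) dy − (1/2)·∫₀¹ g_{m−1}(y) dy for x ∈ (−1,1). Then for every m ≥ 0: g_m is odd half-wave symmetric, the m-th derivative of g_m equals sgn on (−1,0)∪(0,1), and for every k ≥ 1: â_k(g_m)² + b̂_k(g_m)² = 16·((2k−1)π)^{−2(m+1)}. -/

import Mathlib

open MeasureTheory Real Set

noncomputable section

/-- `g` is even half-wave symmetric on `(-1,1)`: `g x = g (x+1)` for a.e. `x ∈ (-1,0)`. -/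
def IsEvenHWS (g : ℝ → ℝ) : Prop :=
  ∀ᵐ x ∂(volume.restrict (Ioo (-1 : ℝ) 0)), g x = g (x + 1)

/-- `g` is odd half-wave symmetric on `(-1,1)`: `g x = -g (x+1)` for a.e. `x ∈ (-1,0)`. -/
def IsOddHWS (g : ℝ → ℝ) : Prop :=
  ∀ᵐ x ∂(volume.restrict (Ioo (-1 : ℝ) 0)), g x = -g (x + 1)

/-- odd Fourier coefficients -/
def aOdd (g : ℝ → ℝ) (k : ℕ) : ℝ := ∫ x in Ioo (-1 : ℝ) 1, g x * Real.cos ((2 * k - 1) * π * x)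

def bOdd (g : ℝ → ℝ) (k : ℕ) : ℝ := ∫ x in Ioo (-1 : ℝ) 1, g x * Real.sin ((2 * k - 1) * π * x)

/-- even Fourier coefficients -/
def aEven (g : ℝ → ℝ) (k : ℕ) : ℝ := ∫ x in Ioo (-1 : ℝ) 1, g x * Real.cos (2 * k * π * x)

def bEven (g : ℝ → ℝ) (k : ℕ) : ℝ := ∫ x in Ioo (-1 : ℝ) 1, g x * Real.sin (2 * k * π * x)

/-- squared L²(0,1) distance of the shifted function `g (· - μ)` to the subspace `V` -/
def uDistSq (g : ℝ → ℝ) (V : Submodule ℝ (ℝ → ℝ)) (μ : ℝ) : ℝ :=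
  ⨅ v : V, ∫ x in Ioo (0 : ℝ) 1, (g (x - μ) - (v : ℝ → ℝ) x) ^ 2

/-- Kolmogorov N-width (worst case over `μ ∈ [0,1]`) of `{g (· - μ) : μ ∈ [0,1]} ⊂ L²(0,1)` -/
def dN (g : ℝ → ℝ) (N : ℕ) : ℝ :=
  ⨅ V : {V : Submodule ℝ (ℝ → ℝ) // FiniteDimensional ℝ V ∧ Module.finrank ℝ V = N},
    ⨆ μ : Icc (0 : ℝ) 1, Real.sqrt (uDistSq g V.1 μ.1)

/-- L²-average N-width of `{g (· - μ) : μ ∈ [0,1]} ⊂ L²(0,1)` -/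
def deltaN (g : ℝ → ℝ) (N : ℕ) : ℝ :=
  ⨅ V : {V : Submodule ℝ (ℝ → ℝ) // FiniteDimensional ℝ V ∧ Module.finrank ℝ V = N},
    Real.sqrt (∫ μ in Ioo (0 : ℝ) 1, uDistSq g V.1 μ)

/-- The recursively defined antiderivatives of the jump: `g₀ = sgn` and
`g_m(x) = ∫₀ˣ g_{m-1} - (1/2)∫₀¹ g_{m-1}`. -/
def gm : ℕ → ℝ → ℝ
  | 0 => fun x => Real.sign x
  | m + 1 => fun x => (∫ y in (0 : ℝ)..x, gm m y) - (1 / 2) * ∫ y in (0 : ℝ)..1, gm m y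

theorem intervalIntegrable_sign (a b : ℝ) : IntervalIntegrable Real.sign volume a b := by
  refine Monotone.intervalIntegrable fun x y hxy => ?_
  rcases lt_trichotomy x 0 with hx | hx | hx <;> rcases lt_trichotomy y 0 with hy | hy | hy <;>
    simp [Real.sign_of_neg, Real.sign_of_pos, hx, hy] <;> linarith

theorem gm_succ (m : ℕ) (x : ℝ) :
    gm (m + 1) x = (∫ y in (0 : ℝ)..x, gm m y) - (1 / 2) * ∫ y in (0 : ℝ)..1, gm m y := rfl

theorem gm_intervalIntegrable_and_continuous_succ (m : ℕ) :
    (∀ a b, IntervalIntegrable (gm m) volume a b) ∧ Continuous (gm (m + 1)) := by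
  have continuous_succ {m : ℕ} (h : ∀ a b, IntervalIntegrable (gm m) volume a b) :
      Continuous (gm (m + 1)) :=
    (intervalIntegral.continuous_primitive h 0).sub continuous_const
  induction m with
  | zero => exact ⟨intervalIntegrable_sign, continuous_succ intervalIntegrable_sign⟩
  | succ m ih =>
    have h : ∀ a b, IntervalIntegrable (gm (m + 1)) volume a b :=
      fun a b => ih.2.intervalIntegrable a b
    exact ⟨h, continuous_succ h⟩

theorem gm_intervalIntegrable (m : ℕ) (a b : ℝ) : IntervalIntegrable (gm m) volume a b :=
  (gm_intervalIntegrable_and_continuous_succ m).1 a b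

theorem continuous_gm_succ (m : ℕ) : Continuous (gm (m + 1)) :=
  (gm_intervalIntegrable_and_continuous_succ m).2

theorem continuousAt_gm (m : ℕ) {x : ℝ} (hx : x ≠ 0) : ContinuousAt (gm m) x := by
  cases m with
  | zero =>
    rcases lt_or_gt_of_ne hx with h | h
    · exact continuousAt_const.congr (f := fun _ => (-1 : ℝ)) <| by
        filter_upwards [Iio_mem_nhds h] with y hy
        exact (Real.sign_of_neg hy).symm
    · exact continuousAt_const.congr (f := fun _ => (1 : ℝ)) <| by
        filter_upwards [Ioi_mem_nhds h] with y hy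
        exact (Real.sign_of_pos hy).symm
  | succ m => exact (continuous_gm_succ m).continuousAt

theorem hasDerivAt_gm_succ (m : ℕ) {x : ℝ} (hx : x ≠ 0) :
    HasDerivAt (gm (m + 1)) (gm m x) x := by
  have hmeas : StronglyMeasurableAtFilter (gm m) (nhds x) volume :=
    ContinuousAt.stronglyMeasurableAtFilter (s := {0}ᶜ) isOpen_compl_singleton
      (fun y hy => continuousAt_gm m hy) x hx
  exact (intervalIntegral.integral_hasDerivAt_right (gm_intervalIntegrable m 0 x) hmeas
    (continuousAt_gm m hx)).sub_const _

theorem iteratedDeriv_gm (m : ℕ) {x : ℝ} (hx : x ≠ 0) :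
    iteratedDeriv m (gm m) x = Real.sign x := by
  induction m with
  | zero => rfl
  | succ m ih =>
    rw [iteratedDeriv_succ', ← ih]
    apply Filter.EventuallyEq.iteratedDeriv_eq
    filter_upwards [isOpen_compl_singleton.mem_nhds hx] with y hy
    exact (hasDerivAt_gm_succ m hy).deriv

theorem gm_succ_eq_neg_of_isOddHWS {m : ℕ} (h : IsOddHWS (gm m)) {x : ℝ}
    (hx : x ∈ Icc (-1 : ℝ) 0) : gm (m + 1) x = -gm (m + 1) (x + 1) := by
  have hshift : ∫ y in x..0, gm m (y + 1) = ∫ y in (x + 1)..1, gm m y := by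
    simp [intervalIntegral.integral_comp_add_right]
  have hneg : ∫ y in x..0, gm m y = ∫ y in x..0, -gm m (y + 1) := by
    rw [intervalIntegral.integral_of_le hx.2, intervalIntegral.integral_of_le hx.2,
      integral_Ioc_eq_integral_Ioo, integral_Ioc_eq_integral_Ioo]
    exact integral_congr_ae (ae_restrict_of_ae_restrict_of_subset (Ioo_subset_Ioo_left hx.1) h)
  have hsplit := intervalIntegral.integral_add_adjacent_intervals
    (gm_intervalIntegrable m 0 (x + 1)) (gm_intervalIntegrable m (x + 1) 1)
  rw [intervalIntegral.integral_neg, hshift] at hneg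
  rw [gm_succ, gm_succ, intervalIntegral.integral_symm x 0]
  linarith

theorem isOddHWS_gm (m : ℕ) : IsOddHWS (gm m) := by
  induction m with
  | zero =>
    filter_upwards [ae_restrict_mem measurableSet_Ioo] with x hx
    change Real.sign x = -Real.sign (x + 1)
    rw [Real.sign_of_neg hx.2, Real.sign_of_pos (by linarith [hx.1])]
  | succ m ih =>
    filter_upwards [ae_restrict_mem measurableSet_Ioo] with x hx
    exact gm_succ_eq_neg_of_isOddHWS ih (Ioo_subset_Icc_self hx)

theorem gm_succ_one_eq_gm_succ_neg_one (m : ℕ) : gm (m + 1) 1 = gm (m + 1) (-1) := by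
  have h₀ := gm_succ_eq_neg_of_isOddHWS (isOddHWS_gm m) (x := 0) (by simp)
  have h₁ := gm_succ_eq_neg_of_isOddHWS (isOddHWS_gm m) (x := -1) (by simp)
  norm_num at h₀ h₁
  linarith

/-- Integration by parts for `gm (m + 1)`, whose derivative `gm m` may fail to exist at `0`. -/
theorem integral_gm_mul_add_gm_succ_mul_deriv (m : ℕ) {f f' : ℝ → ℝ}
    (hf : ∀ x, HasDerivAt f (f' x) x) (hf' : Continuous f') :
    (∫ x in (-1 : ℝ)..1, gm m x * f x) + ∫ x in (-1 : ℝ)..1, gm (m + 1) x * f' x =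
      gm (m + 1) 1 * f 1 - gm (m + 1) (-1) * f (-1) := by
  have hfc : Continuous f := continuous_iff_continuousAt.2 fun x => (hf x).continuousAt
  have h₁ : IntervalIntegrable (fun x => gm m x * f x) volume (-1) 1 :=
    (gm_intervalIntegrable m _ _).mul_continuousOn hfc.continuousOn
  have h₂ : IntervalIntegrable (fun x => gm (m + 1) x * f' x) volume (-1) 1 :=
    ((continuous_gm_succ m).mul hf').intervalIntegrable _ _
  rw [← intervalIntegral.integral_add h₁ h₂]
  exact integral_eq_of_hasDerivAt_off_countable (fun x => gm (m + 1) x * f x) _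
    (countable_singleton (0 : ℝ)) ((continuous_gm_succ m).mul hfc).continuousOn
    (fun x hx => (hasDerivAt_gm_succ m hx.2).mul (hf x)) (h₁.add h₂)

theorem aOdd_eq_intervalIntegral (g : ℝ → ℝ) (k : ℕ) :
    aOdd g k = ∫ x in (-1 : ℝ)..1, g x * Real.cos ((2 * k - 1) * π * x) := by
  rw [aOdd, intervalIntegral.integral_of_le (by norm_num), integral_Ioc_eq_integral_Ioo]

theorem bOdd_eq_intervalIntegral (g : ℝ → ℝ) (k : ℕ) :
    bOdd g k = ∫ x in (-1 : ℝ)..1, g x * Real.sin ((2 * k - 1) * π * x) := by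
  rw [bOdd, intervalIntegral.integral_of_le (by norm_num), integral_Ioc_eq_integral_Ioo]

theorem cos_two_mul_sub_one_mul_pi (k : ℕ) : Real.cos ((2 * k - 1) * π) = -1 := by
  rw [show (2 * (k : ℝ) - 1) * π = k * (2 * π) - π by ring, Real.cos_nat_mul_two_pi_sub_pi]

theorem sin_two_mul_sub_one_mul_pi (k : ℕ) : Real.sin ((2 * k - 1) * π) = 0 := by
  have h := Real.sin_sq_add_cos_sq ((2 * k - 1) * π)
  rw [cos_two_mul_sub_one_mul_pi] at h
  exact pow_eq_zero_iff two_ne_zero |>.1 (by linarith)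

theorem mul_aOdd_gm_succ (m k : ℕ) :
    (2 * k - 1) * π * aOdd (gm (m + 1)) k = -bOdd (gm m) k := by
  have h := integral_gm_mul_add_gm_succ_mul_deriv m
    (f := fun x => Real.sin ((2 * k - 1) * π * x))
    (f' := fun x => Real.cos ((2 * k - 1) * π * x) * ((2 * k - 1) * π))
    (fun x => by simpa using ((hasDerivAt_id x).const_mul ((2 * k - 1) * π)).sin) (by fun_prop)
  simp only [← mul_assoc, intervalIntegral.integral_mul_const, mul_one, mul_neg, Real.sin_neg,
    sin_two_mul_sub_one_mul_pi, mul_zero, neg_zero, sub_zero] at h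
  rw [aOdd_eq_intervalIntegral, bOdd_eq_intervalIntegral]
  linarith

theorem mul_bOdd_gm_succ (m k : ℕ) :
    (2 * k - 1) * π * bOdd (gm (m + 1)) k = aOdd (gm m) k := by
  have h := integral_gm_mul_add_gm_succ_mul_deriv m
    (f := fun x => Real.cos ((2 * k - 1) * π * x))
    (f' := fun x => -Real.sin ((2 * k - 1) * π * x) * ((2 * k - 1) * π))
    (fun x => by simpa using ((hasDerivAt_id x).const_mul ((2 * k - 1) * π)).cos) (by fun_prop)
  simp only [← mul_assoc, intervalIntegral.integral_mul_const, mul_one, mul_neg, Real.cos_neg,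
    cos_two_mul_sub_one_mul_pi, intervalIntegral.integral_neg,
    gm_succ_one_eq_gm_succ_neg_one, sub_self] at h
  rw [aOdd_eq_intervalIntegral, bOdd_eq_intervalIntegral]
  linarith

theorem integral_sign_mul {f : ℝ → ℝ} (hf : Continuous f) :
    ∫ x in (-1 : ℝ)..1, Real.sign x * f x =
      (∫ x in (0 : ℝ)..1, f x) - ∫ x in (-1 : ℝ)..0, f x := by
  have hint (a b : ℝ) : IntervalIntegrable (fun x => Real.sign x * f x) volume a b :=
    (intervalIntegrable_sign a b).mul_continuousOn hf.continuousOn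
  have hneg : ∫ x in (-1 : ℝ)..0, Real.sign x * f x = ∫ x in (-1 : ℝ)..0, -f x := by
    refine intervalIntegral.integral_congr_Ioo_of_le (by norm_num) fun x hx => ?_
    simp [Real.sign_of_neg hx.2]
  have hpos : ∫ x in (0 : ℝ)..1, Real.sign x * f x = ∫ x in (0 : ℝ)..1, f x := by
    refine intervalIntegral.integral_congr_Ioo_of_le (by norm_num) fun x hx => ?_
    simp [Real.sign_of_pos hx.1]
  rw [← intervalIntegral.integral_add_adjacent_intervals (hint (-1) 0) (hint 0 1), hneg, hpos,
    intervalIntegral.integral_neg]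
  ring

theorem two_mul_sub_one_mul_pi_ne_zero (k : ℕ) : (2 * (k : ℝ) - 1) * π ≠ 0 := by
  refine mul_ne_zero (fun h => ?_) Real.pi_ne_zero
  have : 2 * k = 1 := by exact_mod_cast sub_eq_zero.1 h
  omega

theorem aOdd_gm_zero (k : ℕ) : aOdd (gm 0) k = 0 := by
  have hw := two_mul_sub_one_mul_pi_ne_zero k
  rw [aOdd_eq_intervalIntegral]
  refine (integral_sign_mul (by fun_prop)).trans ?_
  rw [intervalIntegral.integral_comp_mul_left Real.cos hw,
    intervalIntegral.integral_comp_mul_left Real.cos hw]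
  simp [sin_two_mul_sub_one_mul_pi]

theorem bOdd_gm_zero (k : ℕ) : bOdd (gm 0) k = 4 / ((2 * k - 1) * π) := by
  have hw := two_mul_sub_one_mul_pi_ne_zero k
  rw [bOdd_eq_intervalIntegral]
  refine (integral_sign_mul (by fun_prop)).trans ?_
  rw [intervalIntegral.integral_comp_mul_left Real.sin hw,
    intervalIntegral.integral_comp_mul_left Real.sin hw, integral_sin, integral_sin]
  simp only [mul_one, mul_zero, mul_neg, Real.cos_neg, Real.cos_zero,
    cos_two_mul_sub_one_mul_pi, smul_eq_mul]
  ring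

theorem aOdd_sq_add_bOdd_sq_gm (m k : ℕ) :
    aOdd (gm m) k ^ 2 + bOdd (gm m) k ^ 2 = 16 / ((2 * k - 1) * π) ^ (2 * (m + 1)) := by
  have hw := two_mul_sub_one_mul_pi_ne_zero k
  induction m with
  | zero =>
    rw [aOdd_gm_zero, bOdd_gm_zero, div_pow]
    norm_num
  | succ m ih =>
    rw [← mul_bOdd_gm_succ, ← neg_sq (bOdd (gm m) k), ← mul_aOdd_gm_succ,
      eq_div_iff (pow_ne_zero _ hw)] at ih
    rw [eq_div_iff (pow_ne_zero _ hw), ← ih]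
    ring

/-- Each `g_m` is odd half-wave symmetric, its `m`-th derivative is the sign function on
`(-1,0) ∪ (0,1)`, and its odd Fourier coefficients satisfy
`â_k² + b̂_k² = 16 ((2k-1)π)^{-2(m+1)}`. -/
theorem gm_properties (m : ℕ) :
    IsOddHWS (gm m) ∧
    (∀ x ∈ Ioo (-1 : ℝ) 0 ∪ Ioo (0 : ℝ) 1, iteratedDeriv m (gm m) x = Real.sign x) ∧
    (∀ k : ℕ, 1 ≤ k →
      (aOdd (gm m) k) ^ 2 + (bOdd (gm m) k) ^ 2 =
        16 / ((2 * k - 1) * π) ^ (2 * (m + 1))) := by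
  refine ⟨isOddHWS_gm m, fun x hx => iteratedDeriv_gm m ?_,
    fun k _ => aOdd_sq_add_bOdd_sq_gm m k⟩
  rcases hx with hx | hx
  · exact hx.2.ne
  · exact hx.1.ne'
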